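/- Let m be a positive integer, τ ∈ ℝ, P an m×m Hermitian positive definite complex matrix, and W₁, W₂ invertible m×m complex matrices with W₁·W₁* = W₂·W₂*. Then tr[(W₁⁻¹ P W₁⁻*)^τ] = tr[(W₂⁻¹ P W₂⁻*)^τ], where the matrix power of a Hermitian positive definite matrix is defined via the spectral calculus. -/

import Mathlib

open Matrix
open scoped Classical ComplexOrder

/-- Real power of a matrix via the spectral calculus (junk value `0` if not Hermitian). -/
noncomputable def mPow {n : ℕ} (A : Matrix (Fin n) (Fin n) ℂ) (τ : ℝ) :
    Matrix (Fin n) (Fin n) ℂ :=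
  if hA : A.IsHermitian then
    (hA.eigenvectorUnitary : Matrix (Fin n) (Fin n) ℂ) *
      Matrix.diagonal (fun i => ((hA.eigenvalues i ^ τ : ℝ) : ℂ)) *
      (star hA.eigenvectorUnitary : Matrix (Fin n) (Fin n) ℂ)
  else 0

/-- The trace of a real power of a Hermitian matrix is the sum of the powers of its eigenvalues. -/
theorem trace_mPow {n : ℕ} {A : Matrix (Fin n) (Fin n) ℂ} (hA : A.IsHermitian) (τ : ℝ) :
    Matrix.trace (mPow A τ) = ∑ i, ((hA.eigenvalues i ^ τ : ℝ) : ℂ) := by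
  rw [mPow, dif_pos hA, Matrix.trace_mul_comm, ← Matrix.mul_assoc]
  simp [Matrix.trace_diagonal]

/-- Hermitian matrices with the same characteristic polynomial have real powers of the same
trace. -/
theorem trace_mPow_eq_of_charpoly_eq {n : ℕ} {A B : Matrix (Fin n) (Fin n) ℂ}
    (hA : A.IsHermitian) (hB : B.IsHermitian) (h : A.charpoly = B.charpoly) (τ : ℝ) :
    Matrix.trace (mPow A τ) = Matrix.trace (mPow B τ) := by
  rw [trace_mPow hA, trace_mPow hB, (hA.eigenvalues_eq_eigenvalues_iff hB).2 h]

theorem isHermitian_inv_mul_mul_conjTranspose_inv {n : ℕ} {P : Matrix (Fin n) (Fin n) ℂ}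
    (hP : P.IsHermitian) (W : Matrix (Fin n) (Fin n) ℂ) :
    (W⁻¹ * P * (Wᴴ)⁻¹).IsHermitian := by
  rw [← Matrix.conjTranspose_nonsing_inv]
  exact Matrix.isHermitian_mul_mul_conjTranspose _ hP

theorem charpoly_inv_mul_mul_conjTranspose_inv {n : ℕ} (P W : Matrix (Fin n) (Fin n) ℂ) :
    (W⁻¹ * P * (Wᴴ)⁻¹).charpoly = (P * (W * Wᴴ)⁻¹).charpoly := by
  rw [Matrix.mul_assoc, Matrix.charpoly_mul_comm, Matrix.mul_assoc, Matrix.mul_inv_rev]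

/-- If `W₁·W₁* = W₂·W₂*` with `W₁, W₂` invertible and `P` is Hermitian positive
definite, then `tr[(W₁⁻¹ P W₁⁻*)^τ] = tr[(W₂⁻¹ P W₂⁻*)^τ]` for every real `τ`. -/
theorem trace_mPow_factor_independent {m : ℕ} (hm : 0 < m) (τ : ℝ)
    (P W₁ W₂ : Matrix (Fin m) (Fin m) ℂ) (hP : P.PosDef)
    (hW₁ : IsUnit W₁.det) (hW₂ : IsUnit W₂.det) (hWW : W₁ * W₁ᴴ = W₂ * W₂ᴴ) :
    Matrix.trace (mPow (W₁⁻¹ * P * (W₁ᴴ)⁻¹) τ) = Matrix.trace (mPow (W₂⁻¹ * P * (W₂ᴴ)⁻¹) τ) := by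
  refine trace_mPow_eq_of_charpoly_eq
    (isHermitian_inv_mul_mul_conjTranspose_inv hP.isHermitian W₁)
    (isHermitian_inv_mul_mul_conjTranspose_inv hP.isHermitian W₂) ?_ τ
  rw [charpoly_inv_mul_mul_conjTranspose_inv, charpoly_inv_mul_mul_conjTranspose_inv, hWW]
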